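/- Let 1 < p < ∞, p′ = p/(p−1), and let (f_j) be a sequence in Aᵖ(𝒰). Then ∫_𝒰 f_j ḡ dV → 0 for every g ∈ L^{p′}(𝒰) if and only if sup_j ‖f_j‖ₚ < ∞ and f_j → 0 uniformly on every compact subset of 𝒰. -/

import Mathlib

open MeasureTheory Filter

noncomputable section

/-- Points of ℂⁿ written `z = (z′, zₙ)` with `z′ ∈ ℂ^m`, `m = n - 1`. -/
abbrev SPoint (m : ℕ) := (Fin m → ℂ) × ℂ

/-- `ρ(z,w) = (i/2)(w̄ₙ − zₙ) − z′·w̄′`. -/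
def srho2 {m : ℕ} (z w : SPoint m) : ℂ :=
  Complex.I / 2 * ((starRingEnd ℂ) w.2 - z.2) - ∑ j, z.1 j * (starRingEnd ℂ) (w.1 j)

/-- `ρ(z) = Im zₙ − |z′|²`. -/
def srho {m : ℕ} (z : SPoint m) : ℝ :=
  z.2.im - ∑ j, ‖z.1 j‖ ^ 2

/-- The Siegel upper half-space `𝒰 = {z : ρ(z) > 0}`. -/
def Siegel (m : ℕ) : Set (SPoint m) := {z | 0 < srho z}

/-- The Bergman kernel `K(z,w) = (n!/(4πⁿ)) ρ(z,w)^{−(n+1)}` (points in ℂⁿ = ℂ^{n-1} × ℂ). -/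
def sK (n : ℕ) (z w : SPoint (n - 1)) : ℂ :=
  (n.factorial : ℂ) / (4 * (Real.pi : ℂ) ^ n) * srho2 z w ^ (-(n + 1 : ℤ))

/-- Inverse hyperbolic tangent. -/
def artanh (x : ℝ) : ℝ := (1 / 2) * Real.log ((1 + x) / (1 - x))

/-- The Bergman distance `β(z,w) = artanh √(1 − ρ(z)ρ(w)/|ρ(z,w)|²)`. -/
def sbeta {m : ℕ} (z w : SPoint m) : ℝ :=
  artanh (Real.sqrt (1 - srho z * srho w / ‖srho2 z w‖ ^ 2))

/-- The Bergman metric ball `D(z,r)`. -/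
def sball {m : ℕ} (z : SPoint m) (r : ℝ) : Set (SPoint m) :=
  {w ∈ Siegel m | sbeta z w < r}

/-- Membership in the Bergman space `Aᵖ(𝒰)`: holomorphic with `∫_𝒰 |f|ᵖ dV < ∞`. -/
def MemAp (n : ℕ) (p : ℝ) (f : SPoint (n - 1) → ℂ) : Prop :=
  DifferentiableOn ℂ f (Siegel (n - 1)) ∧
    IntegrableOn (fun z => ‖f z‖ ^ p) (Siegel (n - 1)) volume

/-- `‖f‖ₚ = (∫_𝒰 |f|ᵖ dV)^{1/p}`. -/
def bNorm (n : ℕ) (p : ℝ) (f : SPoint (n - 1) → ℂ) : ℝ :=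
  (∫ z in Siegel (n - 1), ‖f z‖ ^ p) ^ (1 / p)

/-- The space `𝒮_α` of holomorphic `f` on `𝒰` with `sup_z |zₙ + i|^α |f(z)| < ∞`. -/
def SAlpha (n : ℕ) (α : ℝ) (f : SPoint (n - 1) → ℂ) : Prop :=
  DifferentiableOn ℂ f (Siegel (n - 1)) ∧
    ∃ M : ℝ, ∀ z ∈ Siegel (n - 1), ‖z.2 + Complex.I‖ ^ α * ‖f z‖ ≤ M

end

instance (m : ℕ) : (volume : Measure (SPoint m)).IsAddHaarMeasure :=
  Measure.prod.instIsAddHaarMeasure _ _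

/-- Multiplication by a unimodular scalar preserves Lebesgue measure. -/
theorem measurePreserving_smul_of_norm_eq_one {m : ℕ} {c : ℂ} (hc : ‖c‖ = 1) :
    MeasurePreserving (fun w : SPoint m => c • w) volume volume := by
  have h : MeasurePreserving (fun w : ℂ => c * w) volume volume :=
    (rotation ⟨c, mem_sphere_zero_iff_norm.2 hc⟩).measurePreserving
  exact (volume_preserving_pi fun _ : Fin m => h).prod h

/-- The mean value property of holomorphic functions over polydiscs. -/
theorem setIntegral_closedBall_eq_smul {m : ℕ} {f : SPoint m → ℂ} {z : SPoint m} {r : ℝ}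
    (hf : DifferentiableOn ℂ f (Metric.closedBall z r)) :
    ∫ w in Metric.closedBall z r, f w = volume.real (Metric.closedBall z r) • f z := by
  have hmaps : ∀ ζ : ℂ, ‖ζ‖ ≤ 1 → ∀ w ∈ Metric.closedBall (0 : SPoint m) r,
      z + ζ • w ∈ Metric.closedBall z r := by
    intro ζ hζ w hw
    rw [mem_closedBall_zero_iff] at hw
    rw [mem_closedBall_iff_norm, add_sub_cancel_left, norm_smul]
    nlinarith [norm_nonneg w]
  have hcirc : ∀ θ : ℝ, ‖circleMap 0 1 θ‖ = 1 := fun θ => by simp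
  have hrot : ∀ θ : ℝ, ∫ w in Metric.closedBall (0 : SPoint m) r, f (z + circleMap 0 1 θ • w) =
      ∫ w in Metric.closedBall z r, f w := by
    intro θ
    have hne : circleMap 0 1 θ ≠ 0 := norm_ne_zero_iff.1 (by simp)
    have hmp : MeasurePreserving (fun w : SPoint m => z + circleMap 0 1 θ • w) volume volume :=
      (measurePreserving_add_left volume z).comp (measurePreserving_smul_of_norm_eq_one (hcirc θ))
    have hemb : MeasurableEmbedding (fun w : SPoint m => z + circleMap 0 1 θ • w) :=
      ((Homeomorph.smulOfNeZero _ hne).trans (Homeomorph.addLeft z)).measurableEmbedding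
    rw [← hmp.setIntegral_preimage_emb hemb f]
    congr 2
    ext w
    simp [norm_smul]
  have hline : ∀ w ∈ Metric.closedBall (0 : SPoint m) r,
      ∫ θ in (0 : ℝ)..2 * Real.pi, f (z + circleMap 0 1 θ • w) = (2 * Real.pi) • f z := by
    intro w hw
    have hd : DiffContOnCl ℂ (fun ζ : ℂ => f (z + ζ • w)) (Metric.ball 0 |1|) := by
      refine DifferentiableOn.diffContOnCl ?_
      rw [abs_one, closure_ball _ one_ne_zero]
      exact hf.comp (by fun_prop) fun ζ hζ => hmaps ζ (mem_closedBall_zero_iff.1 hζ) w hw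
    have h := hd.circleAverage
    rw [Real.circleAverage_def, zero_smul, add_zero] at h
    rw [← h, smul_inv_smul₀ (by positivity)]
  have hint : Integrable
      (Function.uncurry fun (θ : ℝ) (w : SPoint m) => f (z + circleMap 0 1 θ • w))
      ((volume.restrict (Set.uIoc 0 (2 * Real.pi))).prod
        (volume.restrict (Metric.closedBall (0 : SPoint m) r))) := by
    rw [Measure.prod_restrict]
    have hc : ContinuousOn
        (Function.uncurry fun (θ : ℝ) (w : SPoint m) => f (z + circleMap 0 1 θ • w))
        (Set.uIcc 0 (2 * Real.pi) ×ˢ Metric.closedBall (0 : SPoint m) r) := by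
      refine hf.continuousOn.comp (f := fun x : ℝ × SPoint m => z + circleMap 0 1 x.1 • x.2)
        (Continuous.continuousOn ?_) fun x hx => hmaps _ (hcirc _).le _ hx.2
      have := continuous_circleMap 0 1
      fun_prop
    exact IntegrableOn.mono_set
      (hc.integrableOn_compact (isCompact_uIcc.prod (isCompact_closedBall _ _)))
      (Set.prod_mono Set.uIoc_subset_uIcc subset_rfl)
  have hswap := intervalIntegral_integral_swap hint
  rw [setIntegral_congr_fun Metric.isClosed_closedBall.measurableSet hline] at hswap
  simp only [hrot, intervalIntegral.integral_const, sub_zero, setIntegral_const] at hswap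
  rw [smul_comm] at hswap
  have := smul_right_injective ℂ (r := 2 * Real.pi) (by positivity) hswap
  rw [this, measureReal_def, measureReal_def, Measure.addHaar_closedBall_center volume z]

/-- Hölder's inequality for the integral of a product. -/
theorem norm_integral_mul_le_Lp_mul_Lq {α : Type*} [MeasurableSpace α] {μ : Measure α}
    {p q : ℝ} (hpq : p.HolderConjugate q) {f g : α → ℂ} (hf : MemLp f (ENNReal.ofReal p) μ)
    (hg : MemLp g (ENNReal.ofReal q) μ) :
    ‖∫ a, f a * g a ∂μ‖ ≤ (∫ a, ‖f a‖ ^ p ∂μ) ^ (1 / p) * (∫ a, ‖g a‖ ^ q ∂μ) ^ (1 / q) := by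
  refine (norm_integral_le_integral_norm _).trans ?_
  simp only [norm_mul]
  exact integral_mul_norm_le_Lp_mul_Lq hpq hf hg

/-- A sequence in `Lᵖ` that is pointwise bounded on `L^q` is norm bounded. -/
theorem exists_integral_norm_rpow_le_of_pairing_bounded {α : Type*} [MeasurableSpace α]
    {μ : Measure α} {p q : ℝ} (hpq : p.HolderConjugate q) {ι : Type*} {f : ι → α → ℂ}
    (hf : ∀ j, MemLp (f j) (ENNReal.ofReal p) μ)
    (hbdd : ∀ g : α → ℂ, MemLp g (ENNReal.ofReal q) μ →
      ∃ C : ℝ, ∀ j, ‖∫ a, f j a * g a ∂μ‖ ≤ C) :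
    ∃ M : ℝ, ∀ j, (∫ a, ‖f j a‖ ^ p ∂μ) ^ (1 / p) ≤ M := by
  have := hpq.ennrealOfReal
  have : Fact (1 ≤ ENNReal.ofReal p) := ⟨by simpa using hpq.lt.le⟩
  have : Fact (1 ≤ ENNReal.ofReal q) := ⟨by simpa using hpq.symm.lt.le⟩
  have hp0 := hpq.pos
  have hq0 := hpq.symm.pos
  let T : ι → Lp ℂ (ENNReal.ofReal q) μ →L[ℂ] ℂ := fun j =>
    (ContinuousLinearMap.mul ℂ ℂ).lpPairing μ (ENNReal.ofReal p) (ENNReal.ofReal q) (hf j).toLp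
  have hT : ∀ j G, T j G = ∫ a, f j a * G a ∂μ := by
    intro j G
    refine (ContinuousLinearMap.lpPairing_eq_integral _ _ _).trans (integral_congr_ae ?_)
    filter_upwards [(hf j).coeFn_toLp] with a ha
    simp [ha]
  obtain ⟨C, hC⟩ := banach_steinhaus (g := T) fun G => by
    simpa only [hT] using hbdd G (Lp.memLp G)
  refine ⟨C, fun j => ?_⟩
  have hC0 : 0 ≤ C := (norm_nonneg _).trans (hC j)
  set I := ∫ a, ‖f j a‖ ^ p ∂μ with hI
  have hI0 : 0 ≤ I := integral_nonneg fun a => by positivity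
  let h : α → ℂ := fun a => (starRingEnd ℂ) (f j a) * ((‖f j a‖ ^ (p - 2) : ℝ) : ℂ)
  have hnorm : ∀ a, ‖h a‖ = ‖f j a‖ ^ (p - 1) := by
    intro a
    rcases (norm_nonneg (f j a)).eq_or_lt with h0 | h0
    · simp [h, ← h0, Real.zero_rpow (sub_ne_zero.2 hpq.lt.ne')]
    · simp only [h, norm_mul, RCLike.norm_conj, Complex.norm_real,
        Real.norm_of_nonneg (Real.rpow_nonneg h0.le _)]
      rw [show p - 1 = 1 + (p - 2) by ring, Real.rpow_add h0, Real.rpow_one]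
  have hnormq : ∀ a, ‖h a‖ ^ q = ‖f j a‖ ^ p := by
    intro a
    rw [hnorm, ← Real.rpow_mul (norm_nonneg _), hpq.sub_one_mul_conj]
  have hmul : ∀ a, f j a * h a = ((‖f j a‖ ^ p : ℝ) : ℂ) := by
    intro a
    rcases (norm_nonneg (f j a)).eq_or_lt with h0 | h0
    · simp [h, norm_eq_zero.1 h0.symm, Real.zero_rpow hp0.ne']
    · simp only [h]
      rw [← mul_assoc, Complex.mul_conj, Complex.normSq_eq_norm_sq, ← Complex.ofReal_mul,
        ← Real.rpow_natCast, ← Real.rpow_add h0]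
      norm_num
  have hmeas : AEStronglyMeasurable h μ := by
    have h1 := (hf j).aestronglyMeasurable
    exact (Complex.continuous_conj.comp_aestronglyMeasurable h1).mul
      (Complex.continuous_ofReal.comp_aestronglyMeasurable
        (h1.norm.aemeasurable.pow_const _).aestronglyMeasurable)
  have hpne : ENNReal.ofReal p ≠ 0 := by simpa using hp0
  have hqne : ENNReal.ofReal q ≠ 0 := by simpa using hq0
  have hmem : MemLp h (ENNReal.ofReal q) μ := by
    rw [← integrable_norm_rpow_iff hmeas hqne ENNReal.ofReal_ne_top, ENNReal.toReal_ofReal hq0.le]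
    simp only [hnormq]
    simpa [ENNReal.toReal_ofReal hp0.le] using
      (integrable_norm_rpow_iff (hf j).1 hpne ENNReal.ofReal_ne_top).2 (hf j)
  have hnormh : ‖hmem.toLp‖ = I ^ (1 / q) := by
    rw [Lp.norm_toLp, toReal_eLpNorm hmeas,
      lpNorm_eq_integral_norm_rpow_toReal hqne ENNReal.ofReal_ne_top hmeas,
      ENNReal.toReal_ofReal hq0.le]
    simp only [hnormq, one_div, hI]
  have hTh : T j hmem.toLp = (I : ℂ) := by
    rw [hT, hI, ← integral_complex_ofReal]
    refine integral_congr_ae ?_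
    filter_upwards [hmem.coeFn_toLp] with a ha
    rw [ha, hmul]
  have hle : I ≤ C * I ^ (1 / q) := by
    have := (T j).le_of_opNorm_le (hC j) hmem.toLp
    rwa [hTh, hnormh, Complex.norm_real, Real.norm_of_nonneg hI0] at this
  rcases hI0.eq_or_lt with h0 | h0
  · rwa [← h0, Real.zero_rpow (one_div_pos.2 hp0).ne']
  · refine le_of_mul_le_mul_right ?_ (Real.rpow_pos_of_pos h0 (1 / q))
    rwa [← Real.rpow_add h0, one_div, one_div, hpq.inv_add_inv_eq_one, Real.rpow_one, ← one_div]

/-- A sequence bounded in `Lᵖ(U)` and converging to zero uniformly on compact subsets of the open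
set `U` converges to zero against every element of `L^q(U)`. -/
theorem tendsto_setIntegral_mul_of_tendstoUniformlyOn {m : ℕ} {U : Set (SPoint m)}
    (hU : IsOpen U) {p q : ℝ} (hpq : p.HolderConjugate q) {f : ℕ → SPoint m → ℂ}
    (hf : ∀ j, MemLp (f j) (ENNReal.ofReal p) (volume.restrict U)) {M : ℝ}
    (hM : ∀ j, (∫ z in U, ‖f j z‖ ^ p) ^ (1 / p) ≤ M)
    (hunif : ∀ E ⊆ U, IsCompact E → TendstoUniformlyOn f 0 atTop E)
    {g : SPoint m → ℂ} (hg : MemLp g (ENNReal.ofReal q) (volume.restrict U)) :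
    Tendsto (fun j => ∫ z in U, f j z * g z) atTop (nhds 0) := by
  have := hpq.ennrealOfReal
  have hp0 := hpq.pos
  have hq0 := hpq.symm.pos
  have hpne : ENNReal.ofReal p ≠ 0 := by simpa using hp0
  have hqne : ENNReal.ofReal q ≠ 0 := by simpa using hq0
  have hM0 : 0 ≤ M := le_trans (by positivity) (hM 0)
  have hgq : Integrable (fun z => ‖g z‖ ^ q) (volume.restrict U) := by
    simpa [ENNReal.toReal_ofReal hq0.le] using
      (integrable_norm_rpow_iff hg.1 hqne ENNReal.ofReal_ne_top).2 hg
  rw [Metric.tendsto_atTop']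
  intro ε hε
  set η := ε / (2 * (M + 1)) with hη
  have hη0 : 0 < η := by positivity
  have hMη : M * η < ε / 2 := by
    rw [hη, ← mul_div_assoc, div_lt_div_iff₀ (by positivity) two_pos]
    nlinarith
  let ν := (volume.restrict U).withDensity fun z => ENNReal.ofReal (‖g z‖ ^ q)
  have : IsFiniteMeasure ν := isFiniteMeasure_withDensity_ofReal hgq.2
  obtain ⟨K, hKU, hK, hKν⟩ := hU.measurableSet.exists_isCompact_sdiff_lt (measure_ne_top ν U)
    (ε := ENNReal.ofReal (η ^ q)) (by simpa using Real.rpow_pos_of_pos hη0 q)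
  have hmeas : MeasurableSet (U \ K) := hU.measurableSet.diff hK.measurableSet
  have hsub : volume.restrict (U \ K) ≤ volume.restrict U :=
    Measure.restrict_mono_set _ Set.sdiff_subset
  have hKsub : volume.restrict K ≤ volume.restrict U := Measure.restrict_mono_set _ hKU
  have htail : (∫ z in U \ K, ‖g z‖ ^ q) ^ (1 / q) ≤ η := by
    have h1 : ENNReal.ofReal (∫ z in U \ K, ‖g z‖ ^ q) = ν (U \ K) := by
      rw [withDensity_apply _ hmeas, Measure.restrict_restrict hmeas,
        Set.inter_eq_left.2 Set.sdiff_subset,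
        ofReal_integral_eq_lintegral_ofReal (hgq.mono_measure hsub)
          (Eventually.of_forall fun z => by positivity)]
    rw [← h1, ENNReal.ofReal_lt_ofReal_iff (by positivity)] at hKν
    calc (∫ z in U \ K, ‖g z‖ ^ q) ^ (1 / q) ≤ (η ^ q) ^ (1 / q) :=
          Real.rpow_le_rpow (integral_nonneg fun z => by positivity) hKν.le (by positivity)
      _ = η := by rw [one_div, Real.rpow_rpow_inv hη0.le hq0.ne']
  have : IsFiniteMeasure (volume.restrict K) := ⟨by simpa using hK.measure_lt_top⟩
  have hgK : Integrable g (volume.restrict K) :=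
    (hg.mono_measure hKsub).integrable (by simpa using hpq.symm.lt.le)
  set G := ∫ z in K, ‖g z‖ with hG
  have hG0 : 0 ≤ G := integral_nonneg fun z => norm_nonneg _
  set c := ε / (2 * (G + 1)) with hc
  have hc0 : 0 < c := by positivity
  have hcG : c * G < ε / 2 := by
    rw [hc, div_mul_eq_mul_div, div_lt_div_iff₀ (by positivity) two_pos]
    nlinarith
  obtain ⟨N, hN⟩ := eventually_atTop.1 (Metric.tendstoUniformlyOn_iff.1 (hunif K hKU hK) c hc0)
  refine ⟨N, fun j hj => ?_⟩
  have hfg : Integrable (fun z => f j z * g z) (volume.restrict U) := (hf j).integrable_mul hg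
  have hsplit : ∫ z in U, f j z * g z = (∫ z in K, f j z * g z) + ∫ z in U \ K, f j z * g z := by
    rw [← setIntegral_union Set.disjoint_sdiff_right hmeas (hfg.mono_measure hKsub)
      (hfg.mono_measure hsub), Set.union_sdiff_cancel hKU]
  have hKle : ‖∫ z in K, f j z * g z‖ ≤ c * G := by
    rw [hG, ← integral_const_mul]
    refine norm_integral_le_of_norm_le (hgK.norm.const_mul c) ?_
    filter_upwards [ae_restrict_mem hK.measurableSet] with z hz
    have := hN j hj.le z hz
    rw [Pi.zero_apply, dist_zero_left] at this
    rw [norm_mul]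
    gcongr
  have hfp : Integrable (fun z => ‖f j z‖ ^ p) (volume.restrict U) := by
    simpa [ENNReal.toReal_ofReal hp0.le] using
      (integrable_norm_rpow_iff (hf j).1 hpne ENNReal.ofReal_ne_top).2 (hf j)
  have hfle : (∫ z in U \ K, ‖f j z‖ ^ p) ^ (1 / p) ≤ M := by
    refine le_trans (Real.rpow_le_rpow (integral_nonneg fun z => by positivity) ?_
      (by positivity)) (hM j)
    exact integral_mono_measure hsub (Eventually.of_forall fun z => by positivity) hfp
  have htle : ‖∫ z in U \ K, f j z * g z‖ ≤ M * η :=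
    (norm_integral_mul_le_Lp_mul_Lq hpq ((hf j).mono_measure hsub) (hg.mono_measure hsub)).trans
      (mul_le_mul hfle htail (by positivity) hM0)
  rw [dist_zero_right, hsplit]
  linarith [norm_add_le (∫ z in K, f j z * g z) (∫ z in U \ K, f j z * g z)]

/-- Holomorphic functions on an open set that are uniformly bounded away from its boundary and
converge pointwise to zero converge to zero uniformly on compact subsets. -/
theorem tendstoUniformlyOn_of_norm_le_of_tendsto {m : ℕ} {U E : Set (SPoint m)}
    (hU : IsOpen U) (hEU : E ⊆ U) (hE : IsCompact E) {f : ℕ → SPoint m → ℂ}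
    (hf : ∀ j, DifferentiableOn ℂ (f j) U)
    (hbdd : ∀ r > 0, ∃ A : ℝ, ∀ j, ∀ z, Metric.closedBall z r ⊆ U → ‖f j z‖ ≤ A)
    (hlim : ∀ z ∈ U, Tendsto (fun j => f j z) atTop (nhds 0)) :
    TendstoUniformlyOn f 0 atTop E := by
  obtain ⟨δ, hδ, hsub⟩ := hE.exists_cthickening_subset_open hU hEU
  have hball : ∀ z ∈ E, Metric.closedBall z δ ⊆ U := fun z hz =>
    (Metric.closedBall_subset_cthickening hz δ).trans hsub
  set r := δ / 2 with hr
  have hr0 : 0 < r := by positivity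
  obtain ⟨A₀, hA₀⟩ := hbdd r hr0
  set A := max A₀ 1 with hA
  have hA0 : 0 < A := lt_max_of_lt_right one_pos
  have hbound : ∀ j, ∀ z ∈ E, ∀ w ∈ Metric.ball z r, ‖f j w‖ ≤ A := fun j z hz w hw =>
    (hA₀ j w ((Metric.closedBall_subset_closedBall' (by
      rw [Metric.mem_ball] at hw; linarith)).trans (hball z hz))).trans (le_max_left _ _)
  have hlip : ∀ j, ∀ z ∈ E, ∀ w ∈ Metric.ball z r, dist (f j w) (f j z) ≤ 2 * A / r * dist w z := by
    intro j z hz w hw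
    refine Complex.dist_le_div_mul_dist_of_mapsTo_ball ((hf j).mono ?_) (fun x hx => ?_) hw
    · exact (Metric.ball_subset_closedBall.trans
        (Metric.closedBall_subset_closedBall (by linarith))).trans (hball z hz)
    · rw [mem_closedBall_iff_norm]
      linarith [norm_sub_le (f j x) (f j z), hbound j z hz x hx,
        hbound j z hz z (Metric.mem_ball_self hr0)]
  rw [Metric.tendstoUniformlyOn_iff]
  intro ε hε
  obtain ⟨t, htE, htfin, hcover⟩ := hE.finite_cover_balls
    (e := min r (ε * r / (4 * A))) (lt_min hr0 (by positivity))
  have hev : ∀ᶠ j in atTop, ∀ z ∈ t, ‖f j z‖ < ε / 2 :=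
    (eventually_all_finite htfin).2 fun z hz =>
      (hlim z (hEU (htE hz))).norm.eventually_lt_const (by simpa using hε)
  filter_upwards [hev] with j hj w hw
  obtain ⟨z, hz, hwz⟩ := Set.mem_iUnion₂.1 (hcover hw)
  rw [Metric.mem_ball, lt_min_iff] at hwz
  have h1 := hlip j z (htE hz) w hwz.1
  have h2 : 2 * A / r * dist w z ≤ 2 * A / r * (ε * r / (4 * A)) := by
    gcongr
    exact hwz.2.le
  have h3 : 2 * A / r * (ε * r / (4 * A)) = ε / 2 := by field_simp; norm_num
  rw [Pi.zero_apply, dist_zero_left]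
  rw [dist_eq_norm] at h1
  have h4 : ‖f j w‖ ≤ ‖f j w - f j z‖ + ‖f j z‖ := by
    simpa using norm_add_le (f j w - f j z) (f j z)
  linarith [hj z hz]

theorem isOpen_siegel (m : ℕ) : IsOpen (Siegel m) := by
  refine isOpen_lt continuous_const ?_
  unfold srho
  fun_prop

theorem MemAp.memLp {n : ℕ} {p : ℝ} (hp : 0 < p) {f : SPoint (n - 1) → ℂ} (hf : MemAp n p f) :
    MemLp f (ENNReal.ofReal p) (volume.restrict (Siegel (n - 1))) := by
  rw [← integrable_norm_rpow_iff
    (hf.1.continuousOn.aestronglyMeasurable (isOpen_siegel _).measurableSet)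
    (by simpa using hp) ENNReal.ofReal_ne_top, ENNReal.toReal_ofReal hp.le]
  exact hf.2

/-- `f_j → 0` weakly in `Aᵖ(𝒰)` (i.e. `∫ f_j ḡ dV → 0` for every
`g ∈ L^{p′}(𝒰)`) iff `sup_j ‖f_j‖ₚ < ∞` and `f_j → 0` uniformly on compacta. -/
theorem weak_convergence_characterization (n : ℕ) (hn : 1 ≤ n) (p : ℝ) (hp : 1 < p)
    (f : ℕ → SPoint (n - 1) → ℂ) (hf : ∀ j, MemAp n p (f j)) :
    (∀ g : SPoint (n - 1) → ℂ,
        MemLp g (ENNReal.ofReal (p / (p - 1))) (volume.restrict (Siegel (n - 1))) →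
        Tendsto (fun j => ∫ z in Siegel (n - 1), f j z * (starRingEnd ℂ) (g z))
          atTop (nhds 0)) ↔
      (∃ M : ℝ, ∀ j, bNorm n p (f j) ≤ M) ∧
        (∀ E : Set (SPoint (n - 1)), E ⊆ Siegel (n - 1) → IsCompact E →
          TendstoUniformlyOn f 0 atTop E) := by
  have hpq : p.HolderConjugate (p / (p - 1)) := (Real.holderConjugate_iff_eq_conjExponent hp).2 rfl
  set q := p / (p - 1) with hq
  set U := Siegel (n - 1) with hUdef
  have hU : IsOpen U := isOpen_siegel _
  have hLp : ∀ j, MemLp (f j) (ENNReal.ofReal p) (volume.restrict U) := fun j =>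
    (hf j).memLp hpq.pos
  constructor
  · intro hweak
    have hweak' : ∀ g : SPoint (n - 1) → ℂ, MemLp g (ENNReal.ofReal q) (volume.restrict U) →
        Tendsto (fun j => ∫ z in U, f j z * g z) atTop (nhds 0) := fun g hg => by
      simpa using hweak (star g) hg.star
    obtain ⟨M, hM⟩ := exists_integral_norm_rpow_le_of_pairing_bounded hpq hLp fun g hg => by
      obtain ⟨C, hC⟩ := (hweak' g hg).norm.bddAbove_range
      exact ⟨C, fun j => hC ⟨j, rfl⟩⟩
    have hind : ∀ (z : SPoint (n - 1)) (r : ℝ), MemLp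
        ((Metric.closedBall z r).indicator fun _ => (1 : ℂ)) (ENNReal.ofReal q)
        (volume.restrict U) := fun z r =>
      memLp_indicator_const _ Metric.isClosed_closedBall.measurableSet _
        (Or.inr (((Measure.restrict_apply_le _ _).trans_lt measure_closedBall_lt_top).ne))
    have hmean : ∀ j (z : SPoint (n - 1)) (r : ℝ), Metric.closedBall z r ⊆ U →
        ∫ w in U, f j w * (Metric.closedBall z r).indicator (fun _ => (1 : ℂ)) w =
          volume.real (Metric.closedBall (0 : SPoint (n - 1)) r) • f j z := by
      intro j z r hzr
      rw [measureReal_def, ← Measure.addHaar_closedBall_center volume z, ← measureReal_def,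
        ← setIntegral_closedBall_eq_smul ((hf j).1.mono hzr)]
      have : ∀ w, f j w * (Metric.closedBall z r).indicator (fun _ => (1 : ℂ)) w =
          (Metric.closedBall z r).indicator (f j) w := fun w => by
        by_cases hw : w ∈ Metric.closedBall z r <;> simp [Set.indicator, hw]
      simp only [this]
      rw [setIntegral_indicator Metric.isClosed_closedBall.measurableSet,
        Set.inter_eq_right.2 hzr]
    have hvol : ∀ r > 0, 0 < volume.real (Metric.closedBall (0 : SPoint (n - 1)) r) := fun r hr =>
      ENNReal.toReal_pos (Metric.measure_closedBall_pos _ _ hr).ne' measure_closedBall_lt_top.ne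
    refine ⟨⟨M, hM⟩, fun E hEU hE => tendstoUniformlyOn_of_norm_le_of_tendsto hU hEU hE
      (fun j => (hf j).1) (fun r hr => ?_) fun z hz => ?_⟩
    · set v := volume.real (Metric.closedBall (0 : SPoint (n - 1)) r) with hv
      refine ⟨M * v ^ (1 / q) / v, fun j z hzr => ?_⟩
      have hnorm : ∫ w in U, ‖(Metric.closedBall z r).indicator (fun _ => (1 : ℂ)) w‖ ^ q = v := by
        have : ∀ w, ‖(Metric.closedBall z r).indicator (fun _ => (1 : ℂ)) w‖ ^ q =
            (Metric.closedBall z r).indicator (fun _ => (1 : ℝ)) w := fun w => by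
          by_cases hw : w ∈ Metric.closedBall z r <;>
            simp [Set.indicator, hw, Real.zero_rpow hpq.symm.pos.ne']
        simp only [this]
        rw [setIntegral_indicator Metric.isClosed_closedBall.measurableSet,
          Set.inter_eq_right.2 hzr, setIntegral_const, smul_eq_mul, mul_one, hv, measureReal_def,
          measureReal_def, Measure.addHaar_closedBall_center volume z]
      have h := norm_integral_mul_le_Lp_mul_Lq hpq (hLp j) (hind z r)
      rw [hmean j z r hzr, hnorm, norm_smul, Real.norm_of_nonneg (hvol r hr).le] at h
      rw [le_div_iff₀' (hvol r hr)]
      exact h.trans (mul_le_mul_of_nonneg_right (hM j) (by positivity))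
    · obtain ⟨r, hr, hzr⟩ := Metric.nhds_basis_closedBall.mem_iff.1 (hU.mem_nhds hz)
      have h := (hweak' _ (hind z r)).const_smul
        (volume.real (Metric.closedBall (0 : SPoint (n - 1)) r))⁻¹
      simpa only [hmean _ z r hzr, inv_smul_smul₀ (hvol r hr).ne', smul_zero] using h
  · rintro ⟨⟨M, hM⟩, hunif⟩ g hg
    exact tendsto_setIntegral_mul_of_tendstoUniformlyOn hU hpq hLp hM hunif hg.star
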